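/- Let 𝓗 be a real Hilbert space, H ∈ (0,1/2], (Ω, ℱ, ℙ) a probability space, and X : 𝓗 → Ω → ℝ a Gaussian process, in the sense that for every n ∈ ℕ and every f : Fin n → 𝓗, the law on ℝⁿ of ω ↦ (X(f_i)(ω))_i is a Gaussian measure. Assume X is centered with E[X(f)] = 0 and covariance E[X(f)·X(g)] = ½(‖f‖^{4H} + ‖g‖^{4H} − ‖f − g‖^{4H}) for all f, g. Let 𝒢 be the set of continuous linear bijections φ : 𝓗 → 𝓗 such that ‖f‖ = ‖g‖ implies ‖φ(f)‖ = ‖φ(g)‖, and set ρ(φ) = ‖φ‖_op². Then X satisfies: (SS2) for every φ ∈ 𝒢, every n and every f : Fin n → 𝓗, the law on ℝⁿ of ω ↦ (X(φ(f_i))(ω))_i equals the law of ω ↦ (ρ(φ)^H · X(f_i)(ω))_i; and (SI2) for every h ∈ 𝓗, every n and all f, g : Fin n → 𝓗, the law of ω ↦ (X(f_i + h)(ω) − X(g_i + h)(ω))_i equals the law of ω ↦ (X(f_i)(ω) − X(g_i)(ω))_i. -/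

import Mathlib

open MeasureTheory

/-- A measure on `Fin n → ℝ` is Gaussian if all its one-dimensional continuous linear
projections are (possibly degenerate) Gaussian laws on `ℝ`. -/
def IsGaussianLaw {n : ℕ} (μ : Measure (Fin n → ℝ)) : Prop :=
  ∀ l : (Fin n → ℝ) →L[ℝ] ℝ, ∃ (c : ℝ) (v : NNReal),
    μ.map l = ProbabilityTheory.gaussianReal c v

open ProbabilityTheory in
lemma aux_hasGaussianLaw {Ω : Type*} [MeasurableSpace Ω] {P : Measure Ω} {n : ℕ}
    {Y : Ω → Fin n → ℝ} (h : IsGaussianLaw (Measure.map Y P)) : HasGaussianLaw Y P :=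
  ⟨isGaussian_of_map_eq_gaussianReal h⟩

open ProbabilityTheory in
lemma aux_dual {n : ℕ} (L : StrongDual ℝ (Fin n → ℝ)) (x : Fin n → ℝ) :
    L x = ∑ i, L (Pi.single i 1) * x i := by
  conv_lhs => rw [pi_eq_sum_univ' x]
  rw [map_sum]
  refine Finset.sum_congr rfl fun i _ => ?_
  rw [map_smul, smul_eq_mul, mul_comm]

open ProbabilityTheory in
lemma aux_charFun {Ω : Type*} [MeasurableSpace Ω] {P : Measure Ω} [IsProbabilityMeasure P]
    {n : ℕ} {Y : Fin n → Ω → ℝ} (hY : HasGaussianLaw (fun ω i => Y i ω) P)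
    (mY : ∀ i, ∫ ω, Y i ω ∂P = 0) (L : StrongDual ℝ (Fin n → ℝ)) :
    charFunDual (Measure.map (fun ω i => Y i ω) P) L =
      Complex.exp (-((∑ i, ∑ j, L (Pi.single i 1) * L (Pi.single j 1) *
        ∫ ω, Y i ω * Y j ω ∂P : ℝ) : ℂ) / 2) := by
  have := hY.isGaussian_map
  have h2 : ∀ i, MemLp (Y i) 2 P := fun i => (hY.eval i).memLp_two
  have h1 : ∀ i, Integrable (Y i) P := fun i => (h2 i).integrable (by norm_num)
  have hm : ∫ ω, L (fun i => Y i ω) ∂P = 0 := by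
    rw [integral_congr_ae (Filter.Eventually.of_forall fun ω => aux_dual L (fun i => Y i ω))]
    rw [integral_finsetSum _ (fun i _ => (h1 i).const_mul _)]
    simp [integral_const_mul, mY]
  have hae : AEMeasurable (fun ω => L (fun i => Y i ω)) P :=
    L.continuous.measurable.comp_aemeasurable hY.aemeasurable
  rw [IsGaussian.charFunDual_eq, integral_map hY.aemeasurable (by fun_prop), integral_complex_ofReal, hm,
    variance_map (by fun_prop) hY.aemeasurable, Function.comp_def,
    variance_of_integral_eq_zero hae hm]
  have : ∫ ω, (L (fun i => Y i ω)) ^ 2 ∂P = ∑ i, ∑ j, L (Pi.single i 1) * L (Pi.single j 1) *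
        ∫ ω, Y i ω * Y j ω ∂P := by
    have hij : ∀ i j, Integrable (fun ω => L (Pi.single i 1) * L (Pi.single j 1) *
        (Y i ω * Y j ω)) P := fun i j => ((h2 i).integrable_mul (h2 j)).const_mul _
    have : ∀ ω, (L (fun i => Y i ω)) ^ 2 = ∑ i, ∑ j, L (Pi.single i 1) * L (Pi.single j 1) *
        (Y i ω * Y j ω) := by
      intro ω
      rw [aux_dual L, sq, Finset.sum_mul_sum]
      exact Finset.sum_congr rfl fun i _ => Finset.sum_congr rfl fun j _ => by ring
    simp_rw [this]
    rw [integral_finsetSum _ (fun i _ => integrable_finsetSum _ fun j _ => hij i j)]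
    refine Finset.sum_congr rfl fun i _ => ?_
    rw [integral_finsetSum _ (fun j _ => hij i j)]
    exact Finset.sum_congr rfl fun j _ => integral_const_mul _ _
  rw [this]
  congr 1
  push_cast
  ring

open ProbabilityTheory in
lemma aux_ext {Ω : Type*} [MeasurableSpace Ω] {P : Measure Ω} [IsProbabilityMeasure P]
    {n : ℕ} {Y Z : Fin n → Ω → ℝ} (hY : HasGaussianLaw (fun ω i => Y i ω) P)
    (hZ : HasGaussianLaw (fun ω i => Z i ω) P)
    (mY : ∀ i, ∫ ω, Y i ω ∂P = 0) (mZ : ∀ i, ∫ ω, Z i ω ∂P = 0)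
    (hc : ∀ i j, ∫ ω, Y i ω * Y j ω ∂P = ∫ ω, Z i ω * Z j ω ∂P) :
    Measure.map (fun ω i => Y i ω) P = Measure.map (fun ω i => Z i ω) P := by
  have := hY.isGaussian_map
  have := hZ.isGaussian_map
  refine Measure.ext_of_charFunDual ?_
  ext L
  rw [aux_charFun hY mY, aux_charFun hZ mZ]
  simp_rw [hc]

lemma aux_norm {E : Type*} [NormedAddCommGroup E] [InnerProductSpace ℝ E] (φ : E →L[ℝ] E)
    (h : ∀ f g : E, ‖f‖ = ‖g‖ → ‖φ f‖ = ‖φ g‖) (f : E) : ‖φ f‖ = ‖φ‖ * ‖f‖ := by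
  by_cases hf : f = 0
  · simp [hf]
  have hf' : 0 < ‖f‖ := norm_pos_iff.2 hf
  refine le_antisymm (φ.le_opNorm f) ?_
  rw [← le_div_iff₀ hf']
  refine φ.opNorm_le_bound (by positivity) fun g => ?_
  have := h g ((‖g‖ / ‖f‖) • f) (by rw [norm_smul]; simp; field_simp)
  rw [this, map_smul, norm_smul]
  simp
  apply le_of_eq
  ring



/-- **The `L²`-indexed fractional Brownian motion is strongly self-similar and weakly
increment stationary.** A centered Gaussian process on a real Hilbert space `𝓗` with
covariance `½(‖f‖^{4H} + ‖g‖^{4H} − ‖f − g‖^{4H})`, `H ∈ (0, 1/2]`, satisfies (SS2) strong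
self-similarity with respect to the group of continuous linear bijections preserving equality
of norms (with `ρ(φ) = ‖φ‖²`), and (SI2) weak `L²`-increment stationarity. -/
theorem L2fBm_is_strongly_selfSimilar_and_weakly_stationary
    (𝓗 : Type*) [NormedAddCommGroup 𝓗] [InnerProductSpace ℝ 𝓗] [CompleteSpace 𝓗]
    (H : ℝ) (hH : H ∈ Set.Ioc (0 : ℝ) (1 / 2))
    (Ω : Type*) [MeasurableSpace Ω] (ℙ : Measure Ω) [IsProbabilityMeasure ℙ]
    (X : 𝓗 → Ω → ℝ)
    (hGauss : ∀ (n : ℕ) (f : Fin n → 𝓗),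
      IsGaussianLaw (Measure.map (fun ω => fun i => X (f i) ω) ℙ))
    (hcent : ∀ f : 𝓗, ∫ ω, X f ω ∂ℙ = 0)
    (hcov : ∀ f g : 𝓗, ∫ ω, X f ω * X g ω ∂ℙ =
      (‖f‖ ^ (4 * H) + ‖g‖ ^ (4 * H) - ‖f - g‖ ^ (4 * H)) / 2) :
    (∀ φ : 𝓗 →L[ℝ] 𝓗, Function.Bijective φ →
      (∀ f g : 𝓗, ‖f‖ = ‖g‖ → ‖φ f‖ = ‖φ g‖) →
      ∀ (n : ℕ) (f : Fin n → 𝓗),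
        Measure.map (fun ω => fun i => X (φ (f i)) ω) ℙ =
          Measure.map (fun ω => fun i => (‖φ‖ ^ 2) ^ H * X (f i) ω) ℙ) ∧
    (∀ (h : 𝓗) (n : ℕ) (f g : Fin n → 𝓗),
      Measure.map (fun ω => fun i => X (f i + h) ω - X (g i + h) ω) ℙ =
        Measure.map (fun ω => fun i => X (f i) ω - X (g i) ω) ℙ) := by
  have hG : ∀ (n : ℕ) (f : Fin n → 𝓗),
      ProbabilityTheory.HasGaussianLaw (fun ω => fun i => X (f i) ω) ℙ :=
    fun n f => aux_hasGaussianLaw (hGauss n f)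
  have h2 : ∀ f, MemLp (X f) 2 ℙ := fun f =>
    ((hG 1 (fun _ => f)).eval 0).memLp_two
  have h1 : ∀ f, Integrable (X f) ℙ := fun f => (h2 f).integrable (by norm_num)
  constructor
  · intro φ _ hφ n f
    have hn := aux_norm φ hφ
    refine aux_ext (Y := fun i ω => X (φ (f i)) ω)
      (Z := fun i ω => (‖φ‖ ^ 2) ^ H * X (f i) ω) (hG n fun i => φ (f i)) ?_ ?_ ?_ ?_
    · exact (hG n f).fun_smul ((‖φ‖ ^ 2) ^ H)
    · exact fun i => hcent _
    · intro i
      rw [integral_const_mul, hcent, mul_zero]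
    · intro i j
      have : ∀ ω, (‖φ‖ ^ 2) ^ H * X (f i) ω * ((‖φ‖ ^ 2) ^ H * X (f j) ω) =
          ‖φ‖ ^ (4 * H) * (X (f i) ω * X (f j) ω) := by
        intro ω
        have : ‖φ‖ ^ (4 * H) = (‖φ‖ ^ 2) ^ H * (‖φ‖ ^ 2) ^ H := by
          rw [← Real.mul_rpow (by positivity) (by positivity), Real.rpow_mul (norm_nonneg _)]
          congr 1
          norm_cast
          ring
        rw [this]; ring
      simp_rw [this]
      rw [integral_const_mul, hcov, hcov, ← map_sub, hn, hn, hn,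
        Real.mul_rpow (norm_nonneg _) (norm_nonneg _),
        Real.mul_rpow (norm_nonneg _) (norm_nonneg _),
        Real.mul_rpow (norm_nonneg _) (norm_nonneg _)]
      ring
  · intro h n f g
    have hGd : ∀ f g : Fin n → 𝓗,
        ProbabilityTheory.HasGaussianLaw (fun ω => fun i => X (f i) ω - X (g i) ω) ℙ := by
      intro f g
      have := (hG (n + n) (Fin.append f g)).map
        (ContinuousLinearMap.pi fun i : Fin n =>
          (ContinuousLinearMap.proj (R := ℝ) (φ := fun _ : Fin (n + n) => ℝ) (Fin.castAdd n i) -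
            ContinuousLinearMap.proj (R := ℝ) (φ := fun _ : Fin (n + n) => ℝ) (Fin.natAdd n i)))
      have he : (fun ω => fun i => X (f i) ω - X (g i) ω) =
          (ContinuousLinearMap.pi fun i : Fin n =>
          (ContinuousLinearMap.proj (R := ℝ) (φ := fun _ : Fin (n + n) => ℝ) (Fin.castAdd n i) -
            ContinuousLinearMap.proj (R := ℝ) (φ := fun _ : Fin (n + n) => ℝ) (Fin.natAdd n i))) ∘
          (fun ω => fun i => X (Fin.append f g i) ω) := by
        ext ω i
        change _ = X (Fin.append f g (Fin.castAdd n i)) ω - X (Fin.append f g (Fin.natAdd n i)) ω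
        rw [Fin.append_left, Fin.append_right]
      rw [he]
      exact this
    have hcd : ∀ a b c d, ∫ ω, (X a ω - X b ω) * (X c ω - X d ω) ∂ℙ =
        (‖a - d‖ ^ (4 * H) + ‖b - c‖ ^ (4 * H) - ‖a - c‖ ^ (4 * H) - ‖b - d‖ ^ (4 * H)) / 2 := by
      intro a b c d
      have hi : ∀ a b, Integrable (fun ω => X a ω * X b ω) ℙ :=
        fun a b => (h2 a).integrable_mul (h2 b)
      have hs : ∀ a b c d, Integrable (fun ω => X a ω * X b ω - X c ω * X d ω) ℙ :=
        fun a b c d => (hi a b).sub (hi c d)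
      have : ∀ ω, (X a ω - X b ω) * (X c ω - X d ω) =
          (X a ω * X c ω - X a ω * X d ω) - (X b ω * X c ω - X b ω * X d ω) := fun ω => by ring
      simp_rw [this]
      rw [integral_sub (hs a c a d) (hs b c b d),
        integral_sub (hi _ _) (hi _ _), integral_sub (hi _ _) (hi _ _), hcov, hcov, hcov, hcov]
      ring
    refine aux_ext (Y := fun i ω => X (f i + h) ω - X (g i + h) ω)
      (Z := fun i ω => X (f i) ω - X (g i) ω) (hGd (fun i => f i + h) fun i => g i + h)
      (hGd f g) ?_ ?_ ?_
    · intro i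
      rw [integral_sub (h1 _) (h1 _), hcent, hcent, sub_zero]
    · intro i
      rw [integral_sub (h1 _) (h1 _), hcent, hcent, sub_zero]
    · intro i j
      simp only [hcd, add_sub_add_right_eq_sub]
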